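/- arXiv:quant-ph/0310097 — 10 statements merged into one kernel-verified Lean document; each statement's English description precedes it below -/
import Mathlib

section
/- Let n and r be natural numbers with r ≤ n, and let M_1, …, M_r be pairwise commuting complex 2^n × 2^n matrices such that M_i^2 = 1 for every i and such that for every nonempty subset T of {1, …, r} the trace of the product ∏_{i ∈ T} M_i equals 0. Then the complex dimension of the joint fixed subspace {v ∈ ℂ^{2^n} : M_i v = v for all i} is exactly 2^{n−r}. -/
/-- Expansion of a product of commuting factors `1 + f i` as a sum over subsets. -/
theorem noncommProd_one_add {ι R : Type*} [DecidableEq ι] [Semiring R] (f : ι → R)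
    (hf : ∀ s : Finset ι, (s : Set ι).Pairwise (Function.onFun Commute f))
    (hg : ∀ s : Finset ι, (s : Set ι).Pairwise (Function.onFun Commute fun i => 1 + f i))
    (s : Finset ι) :
    s.noncommProd (fun i => 1 + f i) (hg s) = ∑ t ∈ s.powerset, t.noncommProd f (hf t) := by
  induction s using Finset.induction_on with
  | empty => simp
  | insert a s ha ih =>
    rw [Finset.noncommProd_insert_of_notMem _ _ _ _ ha, ih, Finset.sum_powerset_insert ha,
      add_mul, one_mul, Finset.mul_sum]
    congr 1
    refine Finset.sum_congr rfl fun t ht => ?_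
    rw [Finset.noncommProd_insert_of_notMem _ _ _ _
      fun h => ha (Finset.mem_powerset.mp ht h)]

/-- An involution is absorbed by a commuting product containing the factor `1 + f a`. -/
theorem mul_noncommProd_one_add {ι R : Type*} [DecidableEq ι] [Semiring R] (f : ι → R)
    (hg : ∀ s : Finset ι, (s : Set ι).Pairwise (Function.onFun Commute fun i => 1 + f i))
    {s : Finset ι} {a : ι} (ha : a ∈ s) (hsq : f a ^ 2 = 1) :
    f a * s.noncommProd (fun i => 1 + f i) (hg s) =
      s.noncommProd (fun i => 1 + f i) (hg s) := by
  rw [← Finset.mul_noncommProd_erase s ha, ← mul_assoc, mul_add, mul_one, ← sq, hsq,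
    add_comm (f a)]

/-- A product of commuting factors `1 + f i` scales a common fixed vector by `2 ^ #s`. -/
theorem noncommProd_one_add_mulVec {ι m R : Type*} [DecidableEq ι] [Fintype m] [DecidableEq m]
    [CommSemiring R] (f : ι → Matrix m m R)
    (hg : ∀ s : Finset ι, (s : Set ι).Pairwise (Function.onFun Commute fun i => 1 + f i))
    (s : Finset ι) {v : m → R} (hv : ∀ i, (f i).mulVec v = v) :
    (s.noncommProd (fun i => 1 + f i) (hg s)).mulVec v = (2 : R) ^ s.card • v := by
  induction s using Finset.induction_on with
  | empty => simp
  | insert a s ha ih =>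
    rw [Finset.noncommProd_insert_of_notMem _ _ _ _ ha, ← Matrix.mulVec_mulVec, ih,
      Matrix.mulVec_smul, Matrix.add_mulVec, Matrix.one_mulVec, hv,
      Finset.card_insert_of_notMem ha, pow_succ, mul_smul, two_smul]

/-- The dimension statement of the stabilizer code theorem: a stabilizer with `r`
independent generators on `n` qubits (pairwise commuting matrices squaring to the
identity, all of whose nonempty products are traceless) has joint `+1`-eigenspace
of dimension `2 ^ (n - r)`. -/
theorem stabilizer_fixed_space_dim (n r : ℕ) (hr : r ≤ n)
    (M : Fin r → Matrix (Fin (2 ^ n)) (Fin (2 ^ n)) ℂ)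
    (hcomm : ∀ i j, Commute (M i) (M j))
    (hsq : ∀ i, M i ^ 2 = 1)
    (htr : ∀ T : Finset (Fin r), T.Nonempty →
      (T.noncommProd M (fun i _ j _ _ => hcomm i j)).trace = 0) :
    Module.finrank ℂ
      ↥(⨅ i, LinearMap.ker (Matrix.toLin' (M i) - LinearMap.id)) = 2 ^ (n - r) := by
  have hf (s : Finset (Fin r)) : (s : Set (Fin r)).Pairwise (Function.onFun Commute M) :=
    fun i _ j _ _ => hcomm i j
  have hg (s : Finset (Fin r)) :
      (s : Set (Fin r)).Pairwise (Function.onFun Commute fun i => 1 + M i) :=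
    fun i _ j _ _ =>
      (Commute.one_left _).add_left ((Commute.one_right _).add_right (hcomm i j))
  set Q := Finset.univ.noncommProd (fun i => 1 + M i) (hg _) with hQ
  have hQtr : Q.trace = 2 ^ n := by
    have hzero (t : Finset (Fin r)) (ht : t ≠ ∅) : (t.noncommProd M (hf t)).trace = 0 :=
      htr t (Finset.nonempty_iff_ne_empty.mpr ht)
    rw [hQ, noncommProd_one_add M hf hg, Matrix.trace_sum,
      Finset.sum_eq_single_of_mem ∅ (Finset.empty_mem_powerset _) fun t _ ht => hzero t ht]
    simp
  have hmem (v : Fin (2 ^ n) → ℂ) :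
      v ∈ ⨅ i, LinearMap.ker (Matrix.toLin' (M i) - LinearMap.id) ↔
        ∀ i, (M i).mulVec v = v := by
    simp [sub_eq_zero]
  have hproj : LinearMap.IsProj (⨅ i, LinearMap.ker (Matrix.toLin' (M i) - LinearMap.id))
      (Matrix.toLin' (((2 : ℂ) ^ r)⁻¹ • Q)) := by
    constructor
    · intro v
      rw [hmem]
      intro i
      rw [Matrix.toLin'_apply, Matrix.mulVec_mulVec, Matrix.mul_smul,
        mul_noncommProd_one_add M hg (Finset.mem_univ i) (hsq i)]
    · intro v hv
      rw [Matrix.toLin'_apply, Matrix.smul_mulVec,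
        noncommProd_one_add_mulVec M hg _ ((hmem v).mp hv), Finset.card_fin, smul_smul,
        inv_mul_cancel₀ (pow_ne_zero r two_ne_zero), one_smul]
  have htrace := hproj.trace
  rw [Matrix.trace_toLin'_eq, Matrix.trace_smul, hQtr, smul_eq_mul] at htrace
  have hpow : (2 : ℂ) ^ n = 2 ^ r * 2 ^ (n - r) := by
    rw [← pow_add, Nat.add_sub_cancel' hr]
  rw [hpow, inv_mul_cancel_left₀ (pow_ne_zero r two_ne_zero)] at htrace
  exact_mod_cast htrace.symm
end

section
/- Let M_1, …, M_r be pairwise commuting complex 2^n × 2^n matrices with M_i^2 = 1 for all i, and let P = ∏_{i=1}^r (1 + M_i)/2 be the projection onto their joint +1-eigenspace. Let A be a complex 2^n × 2^n matrix such that either (a) A = ∏_{i ∈ T} M_i for some subset T of {1, …, r}, or (b) A anticommutes with M_j for some j. Then there exists a scalar c ∈ ℂ (namely c = 1 in case (a) and c = 0 in case (b)) such that P·A·P = c • P. -/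
/-- If every element of a list fixes `p` under left multiplication, so does the product. -/
theorem List.prod_mul_eq_self {R : Type*} [Monoid R] {l : List R} {p : R}
    (h : ∀ e ∈ l, e * p = p) : l.prod * p = p := by
  induction l with
  | nil => simp
  | cons a l ih =>
    rw [List.forall_mem_cons] at h
    rw [List.prod_cons, mul_assoc, ih h.2, h.1]

/-- If `x` commutes with every element of a list and fixes one of them under left
multiplication, then it fixes the product. -/
theorem List.mul_prod_eq_prod_of_mem {R : Type*} [Monoid R] {l : List R} {x e : R}
    (hc : ∀ y ∈ l, Commute x y) (he : e ∈ l) (hx : x * e = e) : x * l.prod = l.prod := by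
  induction l with
  | nil => simp at he
  | cons a l ih =>
    rw [List.forall_mem_cons] at hc
    rw [List.prod_cons, ← mul_assoc]
    rcases List.mem_cons.mp he with rfl | h
    · rw [hx]
    · rw [hc.1.eq, mul_assoc, ih hc.2 h]

/-- The Knill–Laflamme condition for stabilizer codes: if `P` is the projection onto
the joint `+1`-eigenspace of pairwise commuting involutions `M i`, and `A` is either a
product of some of the `M i` or anticommutes with some `M j`, then `P·A·P = c • P`
for some scalar `c`. -/
theorem stabilizer_knill_laflamme (n r : ℕ)
    (M : Fin r → Matrix (Fin (2 ^ n)) (Fin (2 ^ n)) ℂ)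
    (hcomm : ∀ i j, Commute (M i) (M j))
    (hsq : ∀ i, M i ^ 2 = 1)
    (P : Matrix (Fin (2 ^ n)) (Fin (2 ^ n)) ℂ)
    (hP : P = (List.ofFn fun i => (2 : ℂ)⁻¹ • (1 + M i)).prod)
    (A : Matrix (Fin (2 ^ n)) (Fin (2 ^ n)) ℂ)
    (hA : (∃ T : Finset (Fin r), A = T.noncommProd M (fun i _ j _ _ => hcomm i j)) ∨
          (∃ j, A * M j = -(M j * A))) :
    ∃ c : ℂ, P * A * P = c • P := by
  have hcommF : ∀ j, ∀ y ∈ List.ofFn fun i => (2 : ℂ)⁻¹ • (1 + M i), Commute (M j) y := by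
    intro j y hy
    obtain ⟨i, rfl⟩ := (List.mem_ofFn' _ _).mp hy
    exact ((Commute.one_right _).add_right (hcomm j i)).smul_right _
  have hMP : ∀ j, M j * P = P := by
    intro j
    rw [hP]
    refine List.mul_prod_eq_prod_of_mem (hcommF j) ((List.mem_ofFn' _ _).mpr ⟨j, rfl⟩) ?_
    rw [mul_smul_comm, mul_add, mul_one, ← sq, hsq, add_comm]
  have hPM : ∀ j, P * M j = P := by
    intro j
    have h : Commute (M j) P := hP ▸ Commute.list_prod_right _ _ (hcommF j)
    rw [← h.eq, hMP]
  rcases hA with ⟨T, rfl⟩ | ⟨j, hj⟩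
  · have hPP : P * P = P := by
      conv_lhs => enter [1]; rw [hP]
      refine List.prod_mul_eq_self fun e he => ?_
      obtain ⟨i, rfl⟩ := (List.mem_ofFn' _ _).mp he
      rw [smul_mul_assoc, add_mul, one_mul, hMP, ← two_smul ℂ P, smul_smul]
      norm_num
    have hTP : T.noncommProd M (fun i _ j _ _ => hcomm i j) * P = P := by
      refine Finset.noncommProd_induction T M _ (fun B => B * P = P) ?_ (one_mul P)
        fun i _ => hMP i
      intro a b ha hb
      rw [mul_assoc, hb, ha]
    exact ⟨1, by rw [mul_assoc, hTP, hPP, one_smul]⟩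
  · refine ⟨0, ?_⟩
    have h : P * A * P = -(P * A * P) := by
      calc P * A * P = P * (A * M j) * P := by simp only [mul_assoc, hMP]
        _ = -(P * M j * A * P) := by rw [hj]; simp only [mul_neg, neg_mul, mul_assoc]
        _ = -(P * A * P) := by rw [hPM]
    rw [zero_smul]
    ext a b
    exact self_eq_neg.mp (congrFun (congrFun h a) b)
end

section
/- Let M_1 = X⊗Z⊗Z⊗X⊗I, M_2 = I⊗X⊗Z⊗Z⊗X, M_3 = X⊗I⊗X⊗Z⊗Z, M_4 = Z⊗X⊗I⊗X⊗Z be the four stabilizer generators of the five-qubit code. Let f : Fin 5 → {I, X, Y, Z} be a function whose number of non-identity values is at least 1 and at most 2, and let E be the Kronecker product f(0) ⊗ f(1) ⊗ f(2) ⊗ f(3) ⊗ f(4). Then E anticommutes with at least one of M_1, M_2, M_3, M_4. (That is, the five-qubit code detects any Pauli error of weight at most 2.) -/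
open Kronecker

noncomputable section

/-- The Pauli matrix `X`. -/
def PX : Matrix (Fin 2) (Fin 2) ℂ := !![0, 1; 1, 0]

/-- The Pauli matrix `Y`. -/
def PY : Matrix (Fin 2) (Fin 2) ℂ := !![0, -Complex.I; Complex.I, 0]

/-- The Pauli matrix `Z`. -/
def PZ : Matrix (Fin 2) (Fin 2) ℂ := !![1, 0; 0, -1]

/-- Index type for five-fold Kronecker products of 2×2 matrices. -/
abbrev Q5 := ((((Fin 2 × Fin 2) × Fin 2) × Fin 2) × Fin 2)

/-- The five-fold Kronecker product `f 0 ⊗ f 1 ⊗ f 2 ⊗ f 3 ⊗ f 4`. -/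
def kron5 (f : Fin 5 → Matrix (Fin 2) (Fin 2) ℂ) : Matrix Q5 Q5 ℂ :=
  f 0 ⊗ₖ f 1 ⊗ₖ f 2 ⊗ₖ f 3 ⊗ₖ f 4

/-- The four stabilizer generators of the five-qubit code. -/
def M5 : Fin 4 → Matrix Q5 Q5 ℂ :=
  ![kron5 ![PX, PZ, PZ, PX, 1],
    kron5 ![1, PX, PZ, PZ, PX],
    kron5 ![PX, 1, PX, PZ, PZ],
    kron5 ![PZ, PX, 1, PX, PZ]]

/-- The Pauli matrices `I`, `X`, `Y`, `Z`, indexed by `0`, `1`, `2`, `3`. -/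
def pauli : Fin 4 → Matrix (Fin 2) (Fin 2) ℂ := ![1, PX, PY, PZ]

/-- The sign `±1` by which the Pauli matrices with indices `a` and `b` commute. -/
def pauliSign (a b : Fin 4) : ℤ := if a = 0 ∨ b = 0 ∨ a = b then 1 else -1

/-- The Pauli indices of the factors of the four stabilizer generators. -/
def stabilizerIndex : Fin 4 → Fin 5 → Fin 4 :=
  ![![1, 3, 3, 1, 0], ![0, 1, 3, 3, 1], ![1, 0, 1, 3, 3], ![3, 1, 0, 1, 3]]

theorem pauli_mul_comm (a b : Fin 4) :
    pauli a * pauli b = pauliSign a b • (pauli b * pauli a) := by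
  fin_cases a <;> fin_cases b <;> simp [pauli, pauliSign, PX, PY, PZ]

theorem pauli_eq_one_iff (a : Fin 4) : pauli a = 1 ↔ a = 0 := by
  refine ⟨fun h => ?_, fun h => by simp [h, pauli]⟩
  have h01 := congrFun (congrFun h 0) 1
  have h11 := congrFun (congrFun h 1) 1
  fin_cases a
  · rfl
  · simp [pauli, PX] at h01
  · simp [pauli, PY] at h01
  · norm_num [pauli, PZ] at h11

theorem kron5_mul (f g : Fin 5 → Matrix (Fin 2) (Fin 2) ℂ) :
    kron5 f * kron5 g = kron5 fun i => f i * g i := by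
  simp only [kron5, Matrix.mul_kronecker_mul]

theorem kron5_smul (c : Fin 5 → ℤ) (f : Fin 5 → Matrix (Fin 2) (Fin 2) ℂ) :
    (kron5 fun i => c i • f i) = (∏ i, c i) • kron5 f := by
  simp only [kron5, Matrix.smul_kronecker, Matrix.kronecker_smul, smul_smul, Fin.prod_univ_five]
  congr 1
  ring

theorem kron5_pauli_mul_comm (a b : Fin 5 → Fin 4) :
    (kron5 fun i => pauli (a i)) * (kron5 fun i => pauli (b i)) =
      (∏ i, pauliSign (a i) (b i)) •
        ((kron5 fun i => pauli (b i)) * kron5 fun i => pauli (a i)) := by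
  rw [kron5_mul, kron5_mul, ← kron5_smul]
  simp only [← pauli_mul_comm]

theorem M5_eq_kron5_pauli (j : Fin 4) : M5 j = kron5 fun i => pauli (stabilizerIndex j i) := by
  fin_cases j <;> rfl

theorem exists_mul_pauliSign_eq_neg_one :
    ∀ a b c d e : Fin 4,
      1 ≤ (if a ≠ 0 then 1 else 0) + (if b ≠ 0 then 1 else 0) + (if c ≠ 0 then 1 else 0) +
        (if d ≠ 0 then 1 else 0) + (if e ≠ 0 then 1 else 0) →
      (if a ≠ 0 then 1 else 0) + (if b ≠ 0 then 1 else 0) + (if c ≠ 0 then 1 else 0) +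
        (if d ≠ 0 then 1 else 0) + (if e ≠ 0 then 1 else 0) ≤ 2 →
      ∃ j, pauliSign a (stabilizerIndex j 0) * pauliSign b (stabilizerIndex j 1) *
        pauliSign c (stabilizerIndex j 2) * pauliSign d (stabilizerIndex j 3) *
        pauliSign e (stabilizerIndex j 4) = -1 := by
  decide +kernel

theorem exists_prod_pauliSign_eq_neg_one (a : Fin 5 → Fin 4)
    (h1 : 1 ≤ (Finset.univ.filter fun i => a i ≠ 0).card)
    (h2 : (Finset.univ.filter fun i => a i ≠ 0).card ≤ 2) :
    ∃ j, ∏ i, pauliSign (a i) (stabilizerIndex j i) = -1 := by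
  rw [Finset.card_filter, Fin.sum_univ_five] at h1 h2
  simp only [Fin.prod_univ_five]
  exact exists_mul_pauliSign_eq_neg_one _ _ _ _ _ h1 h2

/-- The five-qubit code detects any Pauli error of weight at most 2: any tensor product
of Paulis with between 1 and 2 non-identity factors anticommutes with one of the four
stabilizer generators. -/
theorem five_qubit_code_detects_two_errors
    (f : Fin 5 → Matrix (Fin 2) (Fin 2) ℂ)
    (hf : ∀ i, f i ∈ ({1, PX, PY, PZ} : Set (Matrix (Fin 2) (Fin 2) ℂ)))
    (hw1 : 1 ≤ {i | f i ≠ 1}.ncard) (hw2 : {i | f i ≠ 1}.ncard ≤ 2) :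
    ∃ j : Fin 4, kron5 f * M5 j = -(M5 j * kron5 f) := by
  have hp : ∀ i, ∃ a, f i = pauli a := by
    intro i
    rcases hf i with h | h | h | h
    · exact ⟨0, h⟩
    · exact ⟨1, h⟩
    · exact ⟨2, h⟩
    · exact ⟨3, h⟩
  choose a ha using hp
  obtain rfl : f = fun i => pauli (a i) := funext ha
  have hcard : {i | pauli (a i) ≠ 1}.ncard = (Finset.univ.filter fun i => a i ≠ 0).card := by
    rw [← Set.ncard_coe_finset]
    simp [pauli_eq_one_iff]
  rw [hcard] at hw1 hw2
  obtain ⟨j, hj⟩ := exists_prod_pauliSign_eq_neg_one a hw1 hw2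
  refine ⟨j, ?_⟩
  rw [M5_eq_kron5_pauli, kron5_pauli_mul_comm, hj, neg_one_smul]

end
end

section
/- Let V be a finite-dimensional vector space over ZMod 2 equipped with a nondegenerate alternating bilinear form B, let S be a subspace of V with S ⊆ S^⊥ and S ≠ S^⊥, and let 𝓔 be a finite subset of V with |𝓔| ≥ 2 such that for all distinct E, F ∈ 𝓔 the sum E + F lies in S^⊥ but not in S. Then there exists M ∈ S^⊥ with M ∉ S such that, setting C(M) = {E ∈ 𝓔 : B(M, E) = 0} and A(M) = {E ∈ 𝓔 : B(M, E) = 1}, one has |C(M)| · |A(M)| > (1/2) · |𝓔|(|𝓔|−1)/2. -/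
/-- The nontrivial additive character of `ZMod 2`, with values in `ℝ`. -/
noncomputable def zmodTwoSign (x : ZMod 2) : ℝ := if x = 0 then 1 else -1

lemma zmodTwo_eq_zero_or_one (x : ZMod 2) : x = 0 ∨ x = 1 := by
  revert x; decide

lemma zmodTwoSign_zero : zmodTwoSign 0 = 1 := by simp [zmodTwoSign]

lemma zmodTwoSign_one : zmodTwoSign 1 = -1 := by simp [zmodTwoSign]

lemma zmodTwoSign_add (x y : ZMod 2) :
    zmodTwoSign (x + y) = zmodTwoSign x * zmodTwoSign y := by
  have h : (1 : ZMod 2) + 1 = 0 := by decide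
  rcases zmodTwo_eq_zero_or_one x with rfl | rfl <;>
    rcases zmodTwo_eq_zero_or_one y with rfl | rfl <;>
    simp [zmodTwoSign_zero, zmodTwoSign_one, h]

/-- A nonzero linear functional over `ZMod 2` takes each value equally often. -/
lemma sum_zmodTwoSign_eq_zero {W : Type*} [AddCommGroup W] [Module (ZMod 2) W] [Fintype W]
    (f : W →ₗ[ZMod 2] ZMod 2) (hf : ∃ w, f w ≠ 0) : ∑ w, zmodTwoSign (f w) = 0 := by
  obtain ⟨w₀, hw₀⟩ := hf
  have h₁ : f w₀ = 1 := (zmodTwo_eq_zero_or_one _).resolve_left hw₀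
  have h := Equiv.sum_comp (Equiv.addRight w₀) fun w => zmodTwoSign (f w)
  simp only [Equiv.coe_addRight, map_add, zmodTwoSign_add, h₁, zmodTwoSign_one, mul_neg, mul_one,
    Finset.sum_neg_distrib] at h
  linarith

/-- The signed count of a finite set determines the sizes of its two halves. -/
lemma sq_sum_zmodTwoSign {α : Type*} (s : Finset α) (g : α → ZMod 2) :
    (∑ a ∈ s, zmodTwoSign (g a)) ^ 2 = (s.card : ℝ) ^ 2 -
      4 * (((s.filter fun a => g a = 0).card : ℝ) * ((s.filter fun a => g a = 1).card : ℝ)) := by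
  have hfilter : (s.filter fun a => ¬ g a = 0) = s.filter fun a => g a = 1 :=
    Finset.filter_congr fun a _ => by
      rcases zmodTwo_eq_zero_or_one (g a) with h | h <;> simp [h]
  have hsum : ∑ a ∈ s, zmodTwoSign (g a) =
      ((s.filter fun a => g a = 0).card : ℝ) - ((s.filter fun a => g a = 1).card : ℝ) := by
    simp only [zmodTwoSign]
    rw [Finset.sum_ite, hfilter]
    simp [sub_eq_add_neg]
  have hcard : (s.card : ℝ) =
      ((s.filter fun a => g a = 0).card : ℝ) + ((s.filter fun a => g a = 1).card : ℝ) := by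
    rw [← hfilter]
    exact_mod_cast (Finset.card_filter_add_card_filter_not (s := s) (fun a => g a = 0)).symm
  rw [hsum, hcard]
  ring

/-- A vector outside `S` is detected by some vector orthogonal to `S`. -/
lemma exists_apply_ne_zero_of_notMem {K V : Type*} [Field K] [AddCommGroup V] [Module K V]
    [FiniteDimensional K V] (B : V →ₗ[K] V →ₗ[K] K) (hnd : ∀ v, (∀ u, B v u = 0) → v = 0)
    (S : Submodule K V) {D : V} (hD : D ∉ S) :
    ∃ M : V, (∀ s ∈ S, B M s = 0) ∧ B M D ≠ 0 := by
  have hinj : Function.Injective B := by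
    rw [injective_iff_map_eq_zero]
    exact fun v hv => hnd v fun u => by simp [hv]
  have hsurj : Function.Surjective B :=
    (LinearMap.injective_iff_surjective_of_finrank_eq_finrank
      (Subspace.dual_finrank_eq (K := K) (V := V)).symm).mp hinj
  obtain ⟨f, hfD, hfS⟩ := Submodule.exists_le_ker_of_notMem hD
  obtain ⟨M, rfl⟩ := hsurj f
  exact ⟨M, fun s hs => hfS hs, hfD⟩

/-- Given a stabilizer `S` with `S ≠ N(S)` and a finite set `𝓔` of at least two errors
such that the difference of any two distinct errors lies in `N(S) = S^⊥` but not in `S`,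
there is an element `M ∈ N(S) \ S` which separates more than half of all pairs of
errors: `|C(M)| · |A(M)| > (1/2) · |𝓔|(|𝓔|−1)/2`. -/
theorem exists_separating_normalizer_element
    {V : Type*} [AddCommGroup V] [Module (ZMod 2) V] [FiniteDimensional (ZMod 2) V]
    (B : V →ₗ[ZMod 2] V →ₗ[ZMod 2] ZMod 2)
    (halt : ∀ v, B v v = 0)
    (hnd : ∀ v, (∀ u, B v u = 0) → v = 0)
    (S : Submodule (ZMod 2) V)
    (hS : S ≤ ⨅ s : S, LinearMap.ker (B.flip (s : V)))
    (hSne : S ≠ ⨅ s : S, LinearMap.ker (B.flip (s : V)))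
    (𝓔 : Finset V) (h𝓔 : 2 ≤ 𝓔.card)
    (hdiff : ∀ E ∈ 𝓔, ∀ F ∈ 𝓔, E ≠ F →
      E + F ∈ (⨅ s : S, LinearMap.ker (B.flip (s : V))) ∧ E + F ∉ S) :
    ∃ M ∈ (⨅ s : S, LinearMap.ker (B.flip (s : V))), M ∉ S ∧
      (((𝓔.filter fun E => B M E = 0).card : ℝ) *
          ((𝓔.filter fun E => B M E = 1).card : ℝ) >
        (1 / 2) * ((𝓔.card : ℝ) * ((𝓔.card : ℝ) - 1) / 2)) := by
  classical
  set N : Submodule (ZMod 2) V := ⨅ s : S, LinearMap.ker (B.flip (s : V)) with hN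
  have mem_N (v : V) : v ∈ N ↔ ∀ s ∈ S, B v s = 0 := by
    simp [hN, Submodule.mem_iInf]
  have : Finite V := Module.finite_of_finite (ZMod 2)
  have : Fintype N := Fintype.ofFinite N
  let χ : V → ℝ := fun M => ∑ E ∈ 𝓔, zmodTwoSign (B M E)
  have hcard : (2 : ℝ) ≤ 𝓔.card := by exact_mod_cast h𝓔
  have hpair (E F : V) (hE : E ∈ 𝓔) (hF : F ∈ 𝓔) :
      ∑ M : N, zmodTwoSign (B M E) * zmodTwoSign (B M F) =
        if E = F then (Fintype.card N : ℝ) else 0 := by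
    split_ifs with hEF
    · subst hEF
      simp [← zmodTwoSign_add, CharTwo.add_self_eq_zero, zmodTwoSign_zero]
    · obtain ⟨M, hMS, hM⟩ := exists_apply_ne_zero_of_notMem B hnd S (hdiff E hE F hF hEF).2
      have h := sum_zmodTwoSign_eq_zero ((B.flip (E + F)).comp N.subtype)
        ⟨⟨M, (mem_N M).2 hMS⟩, by simpa using hM⟩
      simpa [zmodTwoSign_add] using h
  have hsum : ∑ M : N, χ M ^ 2 = ∑ _M : N, (𝓔.card : ℝ) := by
    calc ∑ M : N, χ M ^ 2
        = ∑ M : N, ∑ E ∈ 𝓔, ∑ F ∈ 𝓔, zmodTwoSign (B M E) * zmodTwoSign (B M F) := by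
          simp only [χ, sq, Finset.sum_mul_sum]
      _ = ∑ E ∈ 𝓔, ∑ F ∈ 𝓔, ∑ M : N, zmodTwoSign (B M E) * zmodTwoSign (B M F) := by
          rw [Finset.sum_comm]
          exact Finset.sum_congr rfl fun E _ => Finset.sum_comm
      _ = ∑ E ∈ 𝓔, ∑ F ∈ 𝓔, if E = F then (Fintype.card N : ℝ) else 0 :=
          Finset.sum_congr rfl fun E hE => Finset.sum_congr rfl fun F hF => hpair E F hE hF
      _ = ∑ _M : N, (𝓔.card : ℝ) := by
          simp [mul_comm]
  have hχS (M : V) (hM : M ∈ S) : χ M ^ 2 = (𝓔.card : ℝ) ^ 2 := by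
    obtain ⟨E, hE⟩ : 𝓔.Nonempty := Finset.card_pos.mp (by omega)
    have hconst (F : V) (hF : F ∈ 𝓔) : B M F = B M E := by
      by_cases hEF : E = F
      · rw [hEF]
      · have h₀ : B (E + F) M = 0 := (mem_N _).1 (hdiff E hE F hF hEF).1 M hM
        have h₁ : B M (E + F) = 0 := by
          rw [← LinearMap.IsAlt.neg (B := B) halt, h₀, neg_zero]
        rw [map_add] at h₁
        exact (CharTwo.add_eq_zero.mp h₁).symm
    have hχ : χ M = 𝓔.card * zmodTwoSign (B M E) := by
      simp only [χ]
      rw [Finset.sum_congr rfl fun F hF => by rw [hconst F hF]]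
      simp
    have hsq : zmodTwoSign (B M E) ^ 2 = 1 := by
      rw [sq, ← zmodTwoSign_add, CharTwo.add_self_eq_zero, zmodTwoSign_zero]
    rw [hχ, mul_pow, hsq, mul_one]
  by_contra! hcon
  have hlt : ∑ _M : N, (𝓔.card : ℝ) < ∑ M : N, χ M ^ 2 := by
    refine Finset.sum_lt_sum (fun M _ => ?_) ⟨0, Finset.mem_univ _, ?_⟩
    · by_cases hM : (M : V) ∈ S
      · rw [hχS M hM]
        nlinarith
      · have h := hcon M M.2 hM
        have h' := sq_sum_zmodTwoSign 𝓔 fun E => B M E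
        simp only [χ]
        linarith
    · rw [hχS _ (by simp)]
      nlinarith
  exact hlt.ne' hsum
end

section
/- Define the sequence m : ℕ → ℕ by m(0) = 1 and, for i ≥ 1, m(i) is the largest natural number k satisfying k + √k ≤ 2·(m(i−1) + 1), where √ denotes the real square root. Then for every i ≥ 0: 2·m(i) ≥ m(i+1) ≥ ⌊2·(m(i)+1) − √(2·(m(i)+1))⌋, and in particular m(i+1) ≥ 2·m(i) − √(2·m(i)) − 1 as real numbers. -/
/-- The error-reduction sequence: `m 0 = 1` and `m (i+1)` is the largest natural number
`k` with `k + √k ≤ 2·(m i + 1)`. -/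
noncomputable def mseq : ℕ → ℕ
  | 0 => 1
  | i + 1 => sSup {k : ℕ | (k : ℝ) + Real.sqrt k ≤ 2 * ((mseq i : ℝ) + 1)}

theorem isGreatest_mseq_succ (i : ℕ) :
    IsGreatest {k : ℕ | (k : ℝ) + Real.sqrt k ≤ 2 * ((mseq i : ℝ) + 1)} (mseq (i + 1)) := by
  have hbdd : BddAbove {k : ℕ | (k : ℝ) + Real.sqrt k ≤ 2 * ((mseq i : ℝ) + 1)} := by
    refine ⟨2 * (mseq i + 1), fun k (hk : (k : ℝ) + Real.sqrt k ≤ _) => ?_⟩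
    have hsqrt := Real.sqrt_nonneg (k : ℝ)
    have : (k : ℝ) ≤ 2 * ((mseq i : ℝ) + 1) := by linarith
    exact_mod_cast this
  have hne : {k : ℕ | (k : ℝ) + Real.sqrt k ≤ 2 * ((mseq i : ℝ) + 1)}.Nonempty :=
    ⟨0, by
      change ((0 : ℕ) : ℝ) + Real.sqrt ((0 : ℕ) : ℝ) ≤ _
      rw [Nat.cast_zero, Real.sqrt_zero, add_zero]
      positivity⟩
  rw [mseq]
  exact ⟨Nat.sSup_mem hne hbdd, fun k hk => le_csSup hbdd hk⟩

theorem one_le_mseq (i : ℕ) : 1 ≤ mseq i := by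
  cases i with
  | zero => simp [mseq]
  | succ i =>
    refine (isGreatest_mseq_succ i).2 ?_
    have : (0 : ℝ) ≤ mseq i := Nat.cast_nonneg _
    change ((1 : ℕ) : ℝ) + Real.sqrt ((1 : ℕ) : ℝ) ≤ _
    rw [Nat.cast_one, Real.sqrt_one]
    linarith

theorem mseq_succ_le (i : ℕ) : mseq (i + 1) ≤ 2 * mseq i := by
  have hmem : (mseq (i + 1) : ℝ) + Real.sqrt (mseq (i + 1)) ≤ 2 * ((mseq i : ℝ) + 1) :=
    (isGreatest_mseq_succ i).1
  have hpos := one_le_mseq i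
  by_contra! hlt
  have hle : (2 * mseq i + 1 : ℝ) ≤ mseq (i + 1) := by exact_mod_cast hlt
  have hone : (1 : ℝ) < mseq (i + 1) := by exact_mod_cast (by omega : 1 < mseq (i + 1))
  have hsqrt : 1 < Real.sqrt (mseq (i + 1)) := Real.lt_sqrt_of_sq_lt (by simpa using hone)
  linarith

theorem floor_le_mseq_succ (i : ℕ) :
    ⌊2 * ((mseq i : ℝ) + 1) - Real.sqrt (2 * ((mseq i : ℝ) + 1))⌋ ≤ (mseq (i + 1) : ℤ) := by
  set S : ℝ := 2 * ((mseq i : ℝ) + 1)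
  rcases lt_or_ge ⌊S - Real.sqrt S⌋ 0 with hneg | hnonneg
  · omega
  obtain ⟨j, hj⟩ := Int.eq_ofNat_of_zero_le hnonneg
  have hjle : (j : ℝ) ≤ S - Real.sqrt S := by
    have := Int.floor_le (S - Real.sqrt S)
    rw [hj] at this
    exact_mod_cast this
  have hsqrt : Real.sqrt j ≤ Real.sqrt S :=
    Real.sqrt_le_sqrt (by linarith [Real.sqrt_nonneg S])
  rw [hj]
  have hmem : (j : ℝ) + Real.sqrt j ≤ S := by linarith
  exact_mod_cast (isGreatest_mseq_succ i).2 hmem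

/-- Growth bounds on the error-reduction sequence:
`2·m(i) ≥ m(i+1) ≥ ⌊2(m(i)+1) − √(2(m(i)+1))⌋ ≥ 2·m(i) − √(2·m(i)) − 1`. -/
theorem mseq_growth (i : ℕ) :
    2 * mseq i ≥ mseq (i + 1) ∧
    (mseq (i + 1) : ℤ) ≥ ⌊2 * ((mseq i : ℝ) + 1) - Real.sqrt (2 * ((mseq i : ℝ) + 1))⌋ ∧
    (mseq (i + 1) : ℝ) ≥ 2 * (mseq i : ℝ) - Real.sqrt (2 * (mseq i : ℝ)) - 1 := by
  refine ⟨mseq_succ_le i, floor_le_mseq_succ i, ?_⟩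
  have hfloor : (⌊2 * ((mseq i : ℝ) + 1) - Real.sqrt (2 * ((mseq i : ℝ) + 1))⌋ : ℝ) ≤
      mseq (i + 1) := by exact_mod_cast floor_le_mseq_succ i
  have hlt := Int.sub_one_lt_floor (2 * ((mseq i : ℝ) + 1) - Real.sqrt (2 * ((mseq i : ℝ) + 1)))
  have hsqrt : Real.sqrt (2 * ((mseq i : ℝ) + 1)) ≤ Real.sqrt (2 * (mseq i : ℝ)) + 2 := by
    have hsq : Real.sqrt (2 * (mseq i : ℝ)) ^ 2 = 2 * (mseq i : ℝ) := Real.sq_sqrt (by positivity)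
    rw [Real.sqrt_le_left (by positivity)]
    nlinarith [Real.sqrt_nonneg (2 * (mseq i : ℝ))]
  linarith
end

section
/- Define the real sequence δ : ℕ → ℝ for i ≥ 8 by δ(8) = 60 and δ(i+1) = 2·δ(i) − 2^{i/2} − 1, where 2^{i/2} = √(2^i). Then δ(i) ≥ 60·(1.5)^{i−8} for all i ≥ 8; in particular δ(i) ≥ 0 for all i ≥ 8. -/
theorem sqrt_two_pow_add_eight_le (n : ℕ) :
    Real.sqrt (2 ^ (8 + n)) ≤ 16 * (1.5 : ℝ) ^ n := by
  refine Real.sqrt_le_iff.mpr ⟨by positivity, ?_⟩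
  have h : (2 : ℝ) ^ n ≤ (1.5 ^ 2) ^ n := by gcongr; norm_num
  calc (2 : ℝ) ^ (8 + n) = 256 * 2 ^ n := by rw [pow_add]; norm_num
    _ ≤ 256 * (1.5 ^ 2) ^ n := by gcongr
    _ = (16 * 1.5 ^ n) ^ 2 := by rw [mul_pow, ← pow_mul, ← pow_mul, mul_comm 2 n]; norm_num

/-- The induction used to lower-bound the error-reduction sequence: if
`δ(8) = 60` and `δ(i+1) = 2·δ(i) − 2^{i/2} − 1` (where `2^{i/2} = √(2^i)`) for `i ≥ 8`,
then `δ(i) ≥ 60·(1.5)^{i−8}` for all `i ≥ 8`; in particular `δ(i) ≥ 0` for `i ≥ 8`. -/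
theorem delta_lower_bound (δ : ℕ → ℝ) (h8 : δ 8 = 60)
    (hrec : ∀ i, 8 ≤ i → δ (i + 1) = 2 * δ i - Real.sqrt (2 ^ i) - 1) :
    ∀ i, 8 ≤ i → δ i ≥ 60 * (1.5 : ℝ) ^ (i - 8) ∧ δ i ≥ 0 := by
  intro i hi
  obtain ⟨n, rfl⟩ := Nat.exists_eq_add_of_le hi
  have key : 60 * (1.5 : ℝ) ^ n ≤ δ (8 + n) := by
    clear hi
    induction n with
    | zero => simp [h8]
    | succ n ih =>
      have hsqrt := sqrt_two_pow_add_eight_le n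
      have hone : (1 : ℝ) ≤ 1.5 ^ n := one_le_pow₀ (by norm_num)
      rw [← add_assoc, hrec (8 + n) (Nat.le_add_right 8 n), pow_succ]
      linarith
  rw [Nat.add_sub_cancel_left]
  exact ⟨key, le_trans (by positivity) key⟩
end

section
/- Define the sequence m : ℕ → ℕ by m(0) = 1 and, for i ≥ 1, m(i) is the largest natural number k satisfying k + √k ≤ 2·(m(i−1) + 1), where √ denotes the real square root. Then for every i ≥ 8, 2^{i−2} ≤ m(i) ≤ 2^{i−1}. -/
theorem le_mseq_succ_iff (i k : ℕ) :
    k ≤ mseq (i + 1) ↔ (k : ℝ) + √(k : ℝ) ≤ 2 * ((mseq i : ℝ) + 1) := by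
  have hbdd : BddAbove {k : ℕ | (k : ℝ) + √(k : ℝ) ≤ 2 * ((mseq i : ℝ) + 1)} := by
    refine ⟨2 * (mseq i + 1), fun k hk => ?_⟩
    have hk' : (k : ℝ) + √(k : ℝ) ≤ 2 * ((mseq i : ℝ) + 1) := hk
    have hle : (k : ℝ) ≤ 2 * ((mseq i : ℝ) + 1) := by linarith [Real.sqrt_nonneg (k : ℝ)]
    exact_mod_cast hle
  rw [mseq]
  refine ⟨fun h => ?_, fun h => le_csSup hbdd h⟩
  have hmem := Nat.sSup_mem ⟨0, by simp; positivity⟩ hbdd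
  refine le_trans ?_ hmem
  have hcast := Nat.cast_le (α := ℝ).mpr h
  gcongr

theorem le_mseq_succ {i a k b : ℕ} (ha : a ≤ mseq i) (hk : k ≤ b ^ 2)
    (hkb : k + b ≤ 2 * (a + 1)) : k ≤ mseq (i + 1) := by
  rw [le_mseq_succ_iff]
  have hsqrt : √(k : ℝ) ≤ b := Real.sqrt_le_iff.mpr ⟨by positivity, by exact_mod_cast hk⟩
  have hsum : (k : ℝ) + b ≤ 2 * ((mseq i : ℝ) + 1) := by exact_mod_cast hkb.trans (by omega)
  linarith

theorem mseq_succ_le_s14 {i a u c : ℕ} (ha : mseq i ≤ a) (hc : c ^ 2 < u + 1)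
    (hu : 2 * (a + 1) ≤ u + 1 + c) : mseq (i + 1) ≤ u := by
  by_contra! h
  have hle := (le_mseq_succ_iff i (u + 1)).mp h
  have hsqrt : (c : ℝ) < √((u + 1 : ℕ) : ℝ) := Real.lt_sqrt_of_sq_lt (by exact_mod_cast hc)
  have hsum : 2 * ((mseq i : ℝ) + 1) ≤ (u + 1 : ℕ) + (c : ℝ) := by
    exact_mod_cast le_trans (by omega) hu
  linarith

theorem mseq_eight : mseq 8 = 124 := by
  have h0 : mseq 0 = 1 := by rw [mseq]
  apply le_antisymm
  · have h1 : mseq 1 ≤ 2 := mseq_succ_le_s14 (c := 1) h0.le (by norm_num) (by norm_num)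
    have h2 : mseq 2 ≤ 4 := mseq_succ_le_s14 (c := 1) h1 (by norm_num) (by norm_num)
    have h3 : mseq 3 ≤ 7 := mseq_succ_le_s14 (c := 2) h2 (by norm_num) (by norm_num)
    have h4 : mseq 4 ≤ 12 := mseq_succ_le_s14 (c := 3) h3 (by norm_num) (by norm_num)
    have h5 : mseq 5 ≤ 21 := mseq_succ_le_s14 (c := 4) h4 (by norm_num) (by norm_num)
    have h6 : mseq 6 ≤ 37 := mseq_succ_le_s14 (c := 6) h5 (by norm_num) (by norm_num)
    have h7 : mseq 7 ≤ 67 := mseq_succ_le_s14 (c := 8) h6 (by norm_num) (by norm_num)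
    exact mseq_succ_le_s14 (c := 11) h7 (by norm_num) (by norm_num)
  · have h1 : 2 ≤ mseq 1 := le_mseq_succ (b := 2) h0.ge (by norm_num) (by norm_num)
    have h2 : 4 ≤ mseq 2 := le_mseq_succ (b := 2) h1 (by norm_num) (by norm_num)
    have h3 : 7 ≤ mseq 3 := le_mseq_succ (b := 3) h2 (by norm_num) (by norm_num)
    have h4 : 12 ≤ mseq 4 := le_mseq_succ (b := 4) h3 (by norm_num) (by norm_num)
    have h5 : 21 ≤ mseq 5 := le_mseq_succ (b := 5) h4 (by norm_num) (by norm_num)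
    have h6 : 37 ≤ mseq 6 := le_mseq_succ (b := 7) h5 (by norm_num) (by norm_num)
    have h7 : 67 ≤ mseq 7 := le_mseq_succ (b := 9) h6 (by norm_num) (by norm_num)
    exact le_mseq_succ (b := 12) h7 (by norm_num) (by norm_num)

theorem mseq_le_two_pow (i : ℕ) (hi : 8 ≤ i) : mseq i ≤ 2 ^ (i - 1) := by
  induction i, hi using Nat.le_induction with
  | base => norm_num [mseq_eight]
  | succ n hn ih =>
    have hpow : 2 ^ n = 2 * 2 ^ (n - 1) := by rw [← pow_succ']; congr 1; omega
    have hlarge : 2 ^ 7 ≤ 2 ^ (n - 1) := Nat.pow_le_pow_right (by norm_num) (by omega)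
    rw [Nat.add_sub_cancel]
    exact mseq_succ_le_s14 (c := 2) ih (by omega) (by omega)

/-- The term `2 * √2 ^ i` is large enough to absorb the square-root losses of all later steps. -/
theorem two_pow_div_four_add_le_mseq (i : ℕ) (hi : 8 ≤ i) :
    (√2 ^ i) ^ 2 / 4 + 2 * √2 ^ i ≤ (mseq i : ℝ) := by
  have hsq : √2 ^ 2 = (2 : ℝ) := Real.sq_sqrt (by norm_num)
  have h8 : √2 ^ 8 = (16 : ℝ) := by
    rw [show √2 ^ 8 = (√2 ^ 2) ^ 4 by ring, hsq]; norm_num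
  induction i, hi using Nat.le_induction with
  | base => rw [h8, mseq_eight]; norm_num
  | succ n hn ih =>
    have hone : (1 : ℝ) ≤ √2 := Real.one_le_sqrt.mpr (by norm_num)
    have hupper : √2 ≤ (1.42 : ℝ) := Real.sqrt_le_iff.mpr ⟨by norm_num, by norm_num⟩
    have hs : (16 : ℝ) ≤ √2 ^ n := h8 ▸ pow_le_pow_right₀ hone hn
    rw [pow_succ √2 n]
    set s : ℝ := √2 ^ n
    set S : ℝ := s * √2 with hS
    have hSsq : S ^ 2 = 2 * s ^ 2 := by rw [hS, mul_pow, hsq, mul_comm]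
    have hSle : S ≤ 1.42 * s := by rw [hS]; nlinarith
    have hSpos : 0 ≤ S := by positivity
    have hceil := Nat.ceil_lt_add_one (show 0 ≤ S ^ 2 / 4 + 2 * S by positivity)
    have hsqrt : √(⌈S ^ 2 / 4 + 2 * S⌉₊ : ℝ) ≤ S / 2 + 2 :=
      Real.sqrt_le_iff.mpr ⟨by positivity, by nlinarith⟩
    exact Nat.ceil_le.mp ((le_mseq_succ_iff n _).mpr (by linarith))

/-- For `i ≥ 8` the error-reduction sequence satisfies `2^{i−2} ≤ m(i) ≤ 2^{i−1}`. -/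
theorem mseq_pow_two_bounds (i : ℕ) (hi : 8 ≤ i) :
    2 ^ (i - 2) ≤ mseq i ∧ mseq i ≤ 2 ^ (i - 1) := by
  refine ⟨?_, mseq_le_two_pow i hi⟩
  have hlower := two_pow_div_four_add_le_mseq i hi
  have hsq : (√2 ^ i) ^ 2 = (2 : ℝ) ^ (i - 2) * 4 := by
    rw [← pow_mul, mul_comm, pow_mul, Real.sq_sqrt (by norm_num),
      show (4 : ℝ) = 2 ^ 2 by norm_num, ← pow_add, Nat.sub_add_cancel (by omega)]
  have hpos : (0 : ℝ) ≤ √2 ^ i := by positivity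
  have hle : (2 : ℝ) ^ (i - 2) ≤ mseq i := by linarith
  exact_mod_cast hle
end

section
/- Define the sequence m : ℕ → ℕ by m(0) = 1 and, for i ≥ 1, m(i) is the largest natural number k satisfying k + √k ≤ 2·(m(i−1) + 1), where √ denotes the real square root. Then for every natural number j ≥ 0, m(j+2) ≥ 2^j. -/
theorem bddAbove_setOf_add_sqrt_le (c : ℝ) :
    BddAbove {k : ℕ | (k : ℝ) + Real.sqrt k ≤ c} := by
  refine ⟨⌊c⌋₊, fun k hk ↦ Nat.le_floor ?_⟩
  have hk' : (k : ℝ) + Real.sqrt k ≤ c := hk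
  linarith [Real.sqrt_nonneg (k : ℝ)]

theorem le_mseq_succ_s15 {i k : ℕ} (h : (k : ℝ) + Real.sqrt k ≤ 2 * ((mseq i : ℝ) + 1)) :
    k ≤ mseq (i + 1) := by
  rw [mseq]
  exact le_csSup (bddAbove_setOf_add_sqrt_le _) h

theorem lt_mseq_succ_add_sqrt (i : ℕ) :
    2 * ((mseq i : ℝ) + 1) < (mseq (i + 1) : ℝ) + 1 + Real.sqrt ((mseq (i + 1) : ℝ) + 1) := by
  by_contra! h
  have := le_mseq_succ_s15 (i := i) (k := mseq (i + 1) + 1) (by push_cast; exact h)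
  omega

theorem four_le_mseq_two : 4 ≤ mseq 2 := by
  have h1 : 2 ≤ mseq 1 := by
    apply le_mseq_succ_s15
    have : Real.sqrt 2 ≤ 2 := Real.sqrt_le_iff.2 (by norm_num)
    norm_num [mseq]
    linarith
  apply le_mseq_succ_s15
  have h1' : (2 : ℝ) ≤ mseq 1 := by exact_mod_cast h1
  have : Real.sqrt 4 ≤ 2 := Real.sqrt_le_iff.2 (by norm_num)
  push_cast
  linarith

/-- The lower-order term `3 * √(2 ^ j)` makes the bound inductive. -/
theorem two_pow_add_three_mul_sqrt_le_mseq (j : ℕ) :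
    (2 : ℝ) ^ j + 3 * Real.sqrt (2 ^ j) ≤ mseq (j + 2) := by
  induction j with
  | zero =>
    norm_num
    exact four_le_mseq_two
  | succ j ih =>
    have hm := lt_mseq_succ_add_sqrt (j + 2)
    rw [show j + 1 + 2 = j + 2 + 1 by ring, pow_succ, Real.sqrt_mul (by positivity)]
    set k : ℝ := (mseq (j + 2 + 1) : ℝ)
    have hk : 0 ≤ k := Nat.cast_nonneg _
    have hr : Real.sqrt (k + 1) ^ 2 = k + 1 := Real.sq_sqrt (by linarith)
    have hs : Real.sqrt (2 ^ j) ^ 2 = (2 : ℝ) ^ j := Real.sq_sqrt (by positivity)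
    have hs1 : 1 ≤ Real.sqrt (2 ^ j) := Real.one_le_sqrt.2 (one_le_pow₀ (by norm_num))
    have ht : Real.sqrt 2 ≤ 1.415 := Real.sqrt_le_iff.2 (by norm_num)
    set r := Real.sqrt (k + 1)
    set s := Real.sqrt ((2 : ℝ) ^ j)
    set t := Real.sqrt 2
    rw [← hs] at ih ⊢
    by_contra! h
    have hts : s * t ≤ s * 1.415 := by gcongr
    have hlow : 1.755 * s + 1 < r := by linarith
    have hsq : (1.755 * s + 1) ^ 2 < r ^ 2 := by gcongr
    nlinarith

/-- A set of at most `2^j` candidate errors can be reduced to a single error in at most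
`j + 2` rounds: `m(j+2) ≥ 2^j` for every `j`. -/
theorem mseq_ge_pow_two (j : ℕ) : mseq (j + 2) ≥ 2 ^ j := by
  have h : (2 : ℝ) ^ j ≤ mseq (j + 2) := by
    linarith [two_pow_add_three_mul_sqrt_le_mseq j, Real.sqrt_nonneg ((2 : ℝ) ^ j)]
  exact_mod_cast h
end

section
/- Define the sequence m : ℕ → ℕ by m(0) = 1 and, for i ≥ 1, m(i) is the largest natural number k satisfying k + √k ≤ 2·(m(i−1) + 1), where √ denotes the real square root. Let i ≥ 1 and let e, e' be natural numbers with e ≤ m(i) and 2·e' < e + √e. Then e' ≤ m(i−1). -/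
theorem mseq_succ_add_sqrt_le (i : ℕ) :
    (mseq (i + 1) : ℝ) + Real.sqrt (mseq (i + 1)) ≤ 2 * ((mseq i : ℝ) + 1) := by
  have hne : {k : ℕ | (k : ℝ) + Real.sqrt k ≤ 2 * ((mseq i : ℝ) + 1)}.Nonempty :=
    ⟨0, by simp only [Set.mem_ofPred_eq, Nat.cast_zero, Real.sqrt_zero, add_zero]; positivity⟩
  have hbdd : BddAbove {k : ℕ | (k : ℝ) + Real.sqrt k ≤ 2 * ((mseq i : ℝ) + 1)} := by
    refine ⟨2 * (mseq i + 1), fun k hk => ?_⟩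
    have hk' : (k : ℝ) ≤ 2 * ((mseq i : ℝ) + 1) :=
      (le_add_of_nonneg_right (Real.sqrt_nonneg _)).trans hk
    exact_mod_cast hk'
  rw [mseq]
  exact Nat.sSup_mem hne hbdd

/-- The inductive step of the error-reduction argument: if the current set of candidate
errors has size `e ≤ m(i)` and one measurement reduces it to a set of size `e'` with
`2·e' < e + √e`, then `e' ≤ m(i−1)`. -/
theorem mseq_inductive_step (i e e' : ℕ) (hi : 1 ≤ i) (he : e ≤ mseq i)
    (he' : 2 * (e' : ℝ) < (e : ℝ) + Real.sqrt e) :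
    e' ≤ mseq (i - 1) := by
  obtain ⟨j, rfl⟩ := Nat.exists_eq_add_of_le' hi
  rw [Nat.add_sub_cancel]
  have hcast : (e : ℝ) ≤ mseq (j + 1) := by exact_mod_cast he
  have hlt : (e' : ℝ) < mseq j + 1 := by
    linarith [mseq_succ_add_sqrt_le j, Real.sqrt_le_sqrt hcast]
  exact Nat.lt_succ_iff.mp (by exact_mod_cast hlt)
end

section
/- Let j be a natural number and let (e_i)_{i ∈ ℕ} be a sequence of positive integers such that e_0 ≤ 2^j and such that for every i with e_i ≥ 2, one has 2·e_{i+1} < e_i + √(e_i) (real square root). Then there exists an index i ≤ j + 2 with e_i = 1. (This is the combinatorial core of the theorem that for any error set 𝓔 with |𝓔| ≤ 2^j, a two-way entanglement purification protocol can narrow the set of possible errors to a single error using at most j + 2 stabilizer measurements, and hence produce k ≥ n − log₂|𝓔| − 2 perfect EPR pairs from n pairs.) -/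
/-- The bounds `u j = (√2 ^ j + (√2 + 1) / 2) ^ 2` satisfy `u (j + 1) + √(u (j + 1)) ≤ 2 * u j`, and
`u 0 < 5`, so an initial size at most `u j` is reduced to one within `j + 2` steps. -/
theorem exists_eq_one_of_sqrt_le (j : ℕ) (e : ℕ → ℕ)
    (hpos : ∀ i, 0 < e i) (h0 : √(e 0 : ℝ) ≤ √2 ^ j + (√2 + 1) / 2)
    (hstep : ∀ i, 2 ≤ e i → 2 * (e (i + 1) : ℝ) < (e i : ℝ) + √(e i : ℝ)) :
    ∃ i ≤ j + 2, e i = 1 := by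
  have hs : √2 ^ 2 = (2 : ℝ) := Real.sq_sqrt (by norm_num)
  induction j generalizing e with
  | zero =>
    have small : ∀ i, 2 ≤ e i → e i ≤ 4 → 2 * e (i + 1) < e i + 2 := by
      intro i h2 h4
      have hlt := hstep i h2
      have hsq : √(e i : ℝ) ≤ 2 := by
        rw [Real.sqrt_le_left (by norm_num)]
        norm_num
        exact_mod_cast h4
      have : 2 * (e (i + 1) : ℝ) < e i + 2 := by linarith
      exact_mod_cast this
    have h4 : e 0 ≤ 4 := by
      have hs2 : √2 < (1.45 : ℝ) := by
        rw [Real.sqrt_lt' (by norm_num)]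
        norm_num
      have hr := Real.sqrt_nonneg (e 0 : ℝ)
      have hr2 := Real.sq_sqrt (Nat.cast_nonneg (α := ℝ) (e 0))
      have : (e 0 : ℝ) < 5 := by
        rw [pow_zero] at h0
        nlinarith
      have : e 0 < 5 := by exact_mod_cast this
      omega
    by_cases h : e 0 = 1
    · exact ⟨0, by omega, h⟩
    by_cases h' : e 1 = 1
    · exact ⟨1, by omega, h'⟩
    refine ⟨2, le_rfl, ?_⟩
    have p0 := hpos 0
    have p1 := hpos 1
    have p2 := hpos 2
    have s0 : 2 * e 1 < e 0 + 2 := small 0 (by omega) h4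
    have s1 : 2 * e 2 < e 1 + 2 := small 1 (by omega) (by omega)
    omega
  | succ j ih =>
    by_cases h1 : e 0 = 1
    · exact ⟨0, by omega, h1⟩
    have hlt := hstep 0 (by have := hpos 0; omega)
    have hnext : √(e (0 + 1) : ℝ) ≤ √2 ^ j + (√2 + 1) / 2 := by
      rw [Real.sqrt_le_left (by positivity)]
      have hr := Real.sqrt_nonneg (e 0 : ℝ)
      have hr2 := Real.sq_sqrt (Nat.cast_nonneg (α := ℝ) (e 0))
      rw [pow_succ] at h0
      generalize √2 ^ j = y at *
      have hsq := pow_le_pow_left₀ hr h0 2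
      linear_combination hlt / 2 + hsq / 2 + h0 / 2 - hr2 / 2
        + (y ^ 2 / 2 + y / 2 - 1 / 8) * hs
    obtain ⟨i, hi, h⟩ := ih (fun i => e (i + 1)) (fun i => hpos _) hnext fun i => hstep (i + 1)
    exact ⟨i + 1, by omega, h⟩

/-- The combinatorial core of the 2-EPP rate theorem: if `e i` denotes the number of
Pauli errors consistent with the first `i` measurement outcomes, `e 0 ≤ 2^j`, each
`e i` is positive, and each well-chosen measurement shrinks the error set so that
`2·e(i+1) < e(i) + √(e(i))` whenever `e(i) ≥ 2`, then within `j + 2` measurements the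
set of possible errors is narrowed down to a single error. -/
theorem error_set_reduces_to_singleton (j : ℕ) (e : ℕ → ℕ)
    (hpos : ∀ i, 0 < e i) (h0 : e 0 ≤ 2 ^ j)
    (hstep : ∀ i, 2 ≤ e i → 2 * (e (i + 1) : ℝ) < (e i : ℝ) + Real.sqrt (e i)) :
    ∃ i ≤ j + 2, e i = 1 := by
  refine exists_eq_one_of_sqrt_le j e hpos ?_ hstep
  have h : √(e 0 : ℝ) ≤ √2 ^ j := by
    rw [Real.sqrt_le_left (by positivity), ← pow_mul, mul_comm, pow_mul,
      Real.sq_sqrt (by norm_num)]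
    exact_mod_cast h0
  linarith [Real.sqrt_nonneg 2]
end
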